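/- arXiv:2601.19754 — 5 statements merged into one kernel-verified Lean document; each statement's English description precedes it below -/
import Mathlib

section
/- Let P be a partially ordered set, n ∈ ℕ, and x, y : {1, …, n} → P. Suppose there exist permutations σ and ρ of {1, …, n} such that x_k ≤ y_{σ(k)} for all k and y_l ≤ x_{ρ(l)} for all l. Then x_k = y_{σ(k)} for all k; in particular the multisets {x_1, …, x_n} and {y_1, …, y_n} are equal. -/
theorem Equiv.Perm.apply_eq_of_forall_le {ι P : Type*} [Finite ι] [PartialOrder P] {f : ι → P}
    {τ : Equiv.Perm ι} (h : ∀ i, f i ≤ f (τ i)) (i : ι) : f (τ i) = f i := by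
  have hmono : Monotone fun m : ℕ => f ((τ ^ m) i) :=
    monotone_nat_of_le_succ fun m => by
      rw [pow_succ', Equiv.Perm.mul_apply]
      exact h _
  have hle : f ((τ ^ 1) i) ≤ f ((τ ^ orderOf τ) i) := hmono (orderOf_pos τ)
  rw [pow_one, pow_orderOf_eq_one, Equiv.Perm.one_apply] at hle
  exact hle.antisymm (h i)

/-!
STATEMENT 3: the combinatorial core of Lemma 4.6 of the paper.
-/

theorem stmt3 {P : Type*} [PartialOrder P] (n : ℕ) (x y : Fin n → P)
    (σ ρ : Equiv.Perm (Fin n))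
    (hxy : ∀ k, x k ≤ y (σ k)) (hyx : ∀ l, y l ≤ x (ρ l)) :
    (∀ k, x k = y (σ k)) ∧
      (↑(List.ofFn x) : Multiset P) = (↑(List.ofFn y) : Multiset P) := by
  have hτ (k : Fin n) : x (ρ (σ k)) = x k :=
    Equiv.Perm.apply_eq_of_forall_le (τ := ρ * σ) (fun k => (hxy k).trans (hyx (σ k))) k
  have heq (k : Fin n) : x k = y (σ k) := (hxy k).antisymm ((hyx (σ k)).trans_eq (hτ k))
  refine ⟨heq, Multiset.coe_eq_coe.2 ?_⟩
  rw [show x = y ∘ σ from funext heq]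
  exact Equiv.Perm.ofFn_comp_perm σ y
end

section
/- Let Q be a finite quiver with vertex set I and no directed cycles, let a : I → ℕ, and set b_i := a_i − Σ_{arrows i → j of Q} a_j. If a' : I → ℤ satisfies a'_i = max(0, b_i + Σ_{arrows i → j of Q} a'_j) for every i ∈ I, then a'_i = a_i for all i ∈ I. -/
/-!
STATEMENT 7: Lemma 6.6 of the paper. For an acyclic finite quiver, the recursion
a'_i = max(0, b_i + Σ_{i → j} a'_j) with b_i = a_i − Σ_{i → j} a_j forces a' = a.
-/

open Finset

open scoped Classical in
theorem stmt7 {I : Type*} [Fintype I] (Arr : I → I → Prop)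
    (hacyclic : ∀ i, ¬ Relation.TransGen Arr i i)
    (a : I → ℕ) (a' : I → ℤ)
    (ha' : ∀ i, a' i =
      max 0 (((a i : ℤ) - ∑ j ∈ univ.filter (fun j => Arr i j), (a j : ℤ))
        + ∑ j ∈ univ.filter (fun j => Arr i j), a' j)) :
    ∀ i, a' i = (a i : ℤ) := by
  have : IsTrans I (Function.swap (Relation.TransGen Arr)) :=
    ⟨fun _ _ _ hij hjk => hjk.trans hij⟩
  have : Std.Irrefl (Function.swap (Relation.TransGen Arr)) := ⟨hacyclic⟩
  have hwf : WellFounded (Function.swap (Relation.TransGen Arr)) :=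
    Finite.wellFounded_of_trans_of_irrefl _
  intro i
  induction i using hwf.induction with
  | _ i ih =>
    have hsum : ∑ j ∈ univ.filter (fun j => Arr i j), a' j =
        ∑ j ∈ univ.filter (fun j => Arr i j), (a j : ℤ) :=
      sum_congr rfl fun j hj => ih j (.single (mem_filter.mp hj).2)
    rw [ha' i, hsum, sub_add_cancel]
    exact max_eq_right (Int.natCast_nonneg _)
end

section
/- Let Q be a finite quiver with vertex set I having at most one directed path (including paths of length 0) between any ordered pair of vertices. Let a : I → ℕ, set b_k := a_k − Σ_{arrows k → j of Q} a_j, and fix i ∈ I. Let in(i) denote the set of vertices k with a_k > 0 admitting a directed path from k to i all of whose vertices l satisfy a_l > 0. If a'' : I → ℤ satisfies a''_k = max(0, b_k − δ_{k,i} + Σ_{arrows k → j of Q} a''_j) for every k ∈ I (where δ_{k,i} = 1 if k = i and 0 otherwise), then a''_k = a_k − 1 for every k ∈ in(i) and a''_k = a_k for every k ∉ in(i). -/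
/-!
STATEMENT 8: the key computation in the proof of Lemma 6.9 of the paper:
𝛚(Y[β] ⊗ Y(x_i)) = β − dim I_i^β.
-/

open Finset

/-- The quiver has at most one directed path (including length-0 paths) between any
ordered pair of vertices: any two nonempty directed paths, encoded as vertex lists
forming chains along the arrow relation, with the same head and the same last vertex,
coincide. -/
def UniquePaths {I : Type*} (Arr : I → I → Prop) : Prop :=
  ∀ l₁ l₂ : List I, l₁.Chain' Arr → l₂.Chain' Arr → l₁ ≠ [] → l₂ ≠ [] →
    l₁.head? = l₂.head? → l₁.getLast? = l₂.getLast? → l₁ = l₂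

/-- k ∈ in(i): a_k > 0 and there is a directed path from k to i all of whose
vertices l satisfy a_l > 0. -/
def InSupp {I : Type*} (Arr : I → I → Prop) (a : I → ℕ) (i k : I) : Prop :=
  0 < a k ∧ Relation.ReflTransGen (fun u v => 0 < a u ∧ 0 < a v ∧ Arr u v) k i

theorem UniquePaths.chain_unique {I : Type*} {Arr : I → I → Prop} (hU : UniquePaths Arr)
    {k i : I} {l₁ l₂ : List I} (h₁ : (k :: l₁).IsChain Arr) (h₂ : (k :: l₂).IsChain Arr)
    (e₁ : (k :: l₁).getLast? = some i) (e₂ : (k :: l₂).getLast? = some i) : l₁ = l₂ :=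
  (List.cons.inj (hU _ _ h₁ h₂ (by simp) (by simp) (by simp) (e₁.trans e₂.symm))).2

theorem exists_chain_of_reflTransGen {I : Type*} {Arr : I → I → Prop} {k i : I}
    (h : Relation.ReflTransGen Arr k i) :
    ∃ l : List I, (k :: l).IsChain Arr ∧ (k :: l).getLast? = some i := by
  obtain ⟨l, hl, e⟩ := List.exists_isChain_cons_of_relationReflTransGen h
  exact ⟨l, hl, by rw [List.getLast?_eq_some_getLast (List.cons_ne_nil _ _), e]⟩

theorem UniquePaths.not_reflTransGen_of_arr {I : Type*} {Arr : I → I → Prop}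
    (hU : UniquePaths Arr) {k j : I} (hkj : Arr k j) : ¬ Relation.ReflTransGen Arr j k := by
  intro h
  obtain ⟨l, hl, e⟩ := exists_chain_of_reflTransGen h
  have := hU.chain_unique (l₁ := j :: l) (l₂ := []) (k := k) (i := k)
    (List.isChain_cons_cons.2 ⟨hkj, hl⟩) (by simp) (by rw [List.getLast?_cons_cons, e]) (by simp)
  simp at this

theorem UniquePaths.eq_of_arr {I : Type*} {Arr : I → I → Prop}
    (hU : UniquePaths Arr) {k j j' i : I} (hj : Arr k j) (hj' : Arr k j')
    (h : Relation.ReflTransGen Arr j i) (h' : Relation.ReflTransGen Arr j' i) : j = j' := by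
  obtain ⟨l, hl, e⟩ := exists_chain_of_reflTransGen h
  obtain ⟨l', hl', e'⟩ := exists_chain_of_reflTransGen h'
  exact (List.cons.inj (hU.chain_unique (k := k) (i := i)
    (List.isChain_cons_cons.2 ⟨hj, hl⟩) (List.isChain_cons_cons.2 ⟨hj', hl'⟩)
    (by rw [List.getLast?_cons_cons, e]) (by rw [List.getLast?_cons_cons, e']))).1

theorem UniquePaths.wellFounded_flip {I : Type*} [Finite I] {Arr : I → I → Prop}
    (hU : UniquePaths Arr) : WellFounded (flip Arr) := by
  have : Std.Irrefl (Relation.TransGen (flip Arr)) := ⟨fun k h => by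
    obtain ⟨j, hj, hjk⟩ := Relation.TransGen.head'_iff.1 (Relation.transGen_swap.1 h)
    exact hU.not_reflTransGen_of_arr hj hjk⟩
  exact Subrelation.wf (fun h => Relation.TransGen.single h)
    (Finite.wellFounded_of_trans_of_irrefl (Relation.TransGen (flip Arr)))

theorem InSupp.reflTransGen {I : Type*} {Arr : I → I → Prop} {a : I → ℕ} {i k : I}
    (h : InSupp Arr a i k) : Relation.ReflTransGen Arr k i :=
  Relation.ReflTransGen.mono (fun _ _ h => h.2.2) _ _ h.2

theorem inSupp_iff {I : Type*} {Arr : I → I → Prop} {a : I → ℕ} {i k : I} :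
    InSupp Arr a i k ↔ 0 < a k ∧ (k = i ∨ ∃ j, Arr k j ∧ InSupp Arr a i j) := by
  refine and_congr_right fun hk => ?_
  rw [Relation.ReflTransGen.cases_head_iff]
  refine or_congr_right (exists_congr fun j => ?_)
  unfold InSupp
  tauto

open scoped Classical in
/-- Under uniqueness of paths, the condition `k = i` and the arrows from `k` into the set of
vertices satisfying `InSupp` are mutually exclusive, and there is at most one such arrow. -/
theorem UniquePaths.ite_add_sum_inSupp {I : Type*} [Fintype I] {Arr : I → I → Prop}
    (hU : UniquePaths Arr) (a : I → ℕ) (i k : I) :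
    (if k = i then (1 : ℤ) else 0) +
        ∑ j ∈ univ.filter (fun j => Arr k j), (if InSupp Arr a i j then (1 : ℤ) else 0) =
      if k = i ∨ ∃ j, Arr k j ∧ InSupp Arr a i j then 1 else 0 := by
  by_cases hex : ∃ j, Arr k j ∧ InSupp Arr a i j
  · obtain ⟨j, hj, hjs⟩ := hex
    have hki : k ≠ i := by
      rintro rfl
      exact hU.not_reflTransGen_of_arr hj hjs.reflTransGen
    rw [Finset.sum_eq_single_of_mem j (by simp [hj]), if_pos hjs, if_neg hki,
      if_pos (Or.inr ⟨j, hj, hjs⟩), zero_add]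
    intro j' hj' hne
    refine if_neg fun hjs' => hne ?_
    exact hU.eq_of_arr (by simpa using hj') hj hjs'.reflTransGen hjs.reflTransGen
  · rw [Finset.sum_eq_zero, add_zero]
    · simp only [hex, or_false]
    · intro j hj
      exact if_neg fun hjs => hex ⟨j, by simpa using hj, hjs⟩

open scoped Classical in
theorem stmt8 {I : Type*} [Fintype I] (Arr : I → I → Prop)
    (hU : UniquePaths Arr)
    (a : I → ℕ) (i : I) (a'' : I → ℤ)
    (ha'' : ∀ k, a'' k =
      max 0 ((((a k : ℤ) - ∑ j ∈ univ.filter (fun j => Arr k j), (a j : ℤ))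
        - (if k = i then 1 else 0))
        + ∑ j ∈ univ.filter (fun j => Arr k j), a'' j)) :
    ∀ k, (InSupp Arr a i k → a'' k = (a k : ℤ) - 1) ∧
      (¬ InSupp Arr a i k → a'' k = (a k : ℤ)) := by
  suffices h : ∀ k, a'' k = a k - if InSupp Arr a i k then 1 else 0 from
    fun k => ⟨fun hk => by rw [h, if_pos hk], fun hk => by rw [h, if_neg hk, sub_zero]⟩
  intro k
  induction k using hU.wellFounded_flip.induction with
  | _ k ih =>
    have hsum : ∑ j ∈ univ.filter (fun j => Arr k j), a'' j =
        ∑ j ∈ univ.filter (fun j => Arr k j), (a j : ℤ) -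
          ∑ j ∈ univ.filter (fun j => Arr k j), (if InSupp Arr a i j then (1 : ℤ) else 0) := by
      rw [← Finset.sum_sub_distrib]
      exact Finset.sum_congr rfl fun j hj => ih j (by simpa [flip] using hj)
    have hcount := hU.ite_add_sum_inSupp a i k
    rw [ha'' k, hsum]
    by_cases hP : k = i ∨ ∃ j, Arr k j ∧ InSupp Arr a i j
    · rw [if_pos hP] at hcount
      by_cases hk : 0 < a k
      · rw [if_pos (inSupp_iff.2 ⟨hk, hP⟩)]
        omega
      · rw [if_neg fun h : InSupp Arr a i k => hk h.1]
        omega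
    · rw [if_neg hP] at hcount
      rw [if_neg fun h => hP (inSupp_iff.1 h).2]
      omega
end

section
/- Let Q be a finite quiver with vertex set I, with no loops and no multiple arrows; write i ∼ j when i and j are joined by an arrow (in either direction). Let ξ : I → ℤ be a height function adapted to Q, i.e. ξ(j) = ξ(i) − 1 for every arrow i → j of Q. Let a : I → ℕ, set b_k := a_k − Σ_{arrows k → j} a_j, c_k := max(b_k, 0), d_k := max(−b_k, 0), and in the free abelian group with basis (Y_{i,p})_{(i,p) ∈ I × ℤ}, set A_{i,p} := Y_{i,p−1} + Y_{i,p+1} − Σ_{j ∼ i} Y_{j,p} and 𝔪_a := Σ_{k ∈ I} (c_k Y_{k,ξ(k)−2} + d_k Y_{k,ξ(k)}). Suppose i ∈ I satisfies b_i ≥ 1, and let a' := a − e_i (where e_i is the indicator of i; note a_i ≥ b_i ≥ 1). Then 𝔪_a + Y_{i,ξ(i)} − A_{i,ξ(i)−1} = 𝔪_{a'} + Σ_{arrows i → j} Y_{j,ξ(j)} + Σ_{arrows j → i with b_j < 0} (Y_{j,ξ(j)−2} + Y_{j,ξ(j)}). -/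
/-!
STATEMENT 12: the dominant-monomial identity (in additive notation) from the proof of
Proposition 7.5 of the paper, for a sink i of the support quiver with b_i ≥ 1:
𝔪_a + Y_{i,ξ(i)} − A_{i,ξ(i)−1}
  = 𝔪_{a−e_i} + Σ_{i → j} Y_{j,ξ(j)} + Σ_{j → i, b_j < 0} (Y_{j,ξ(j)−2} + Y_{j,ξ(j)}).
-/

open Finset

/-- Y_{i,p}: the basis element `single (i,p) 1` of the free abelian group (I × ℤ) →₀ ℤ. -/
noncomputable def Ymon {I : Type*} (q : I × ℤ) : (I × ℤ) →₀ ℤ := Finsupp.single q 1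

open scoped Classical in
/-- A_{i,p} := Y_{i,p−1} + Y_{i,p+1} − Σ_{j ∼ i} Y_{j,p}. -/
noncomputable def Amon {I : Type*} [Fintype I] (Arr : I → I → Prop) (i : I) (p : ℤ) :
    (I × ℤ) →₀ ℤ :=
  Ymon (i, p - 1) + Ymon (i, p + 1)
    - ∑ j ∈ univ.filter (fun j => Arr i j ∨ Arr j i), Ymon (j, p)

open scoped Classical in
/-- b_k := a_k − Σ_{arrows k → j} a_j. -/
noncomputable def bInt {I : Type*} [Fintype I] (Arr : I → I → Prop) (a : I → ℕ) (k : I) : ℤ :=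
  (a k : ℤ) - ∑ j ∈ univ.filter (fun j => Arr k j), (a j : ℤ)

/-- 𝔪_a := Σ_k (c_k Y_{k,ξ(k)−2} + d_k Y_{k,ξ(k)}), with c_k = max(b_k,0) and
d_k = max(−b_k,0). -/
noncomputable def mMon {I : Type*} [Fintype I] (Arr : I → I → Prop) (ξ : I → ℤ)
    (a : I → ℕ) : (I × ℤ) →₀ ℤ :=
  ∑ k, (max (bInt Arr a k) 0 • Ymon (k, ξ k - 2) + max (-(bInt Arr a k)) 0 • Ymon (k, ξ k))

open scoped Classical in
/-- Removing one unit of `a` at `i` lowers `b_i` by one and raises `b_k` by one for `k → i`. -/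
theorem bInt_sub_single {I : Type*} [Fintype I] (Arr : I → I → Prop) (a : I → ℕ) (i : I)
    (hai : 1 ≤ a i) (k : I) :
    bInt Arr (fun k => a k - (if k = i then 1 else 0)) k
      = bInt Arr a k - (if k = i then 1 else 0) + (if Arr k i then 1 else 0) := by
  have hcast : ∀ j, ((a j - (if j = i then 1 else 0) : ℕ) : ℤ)
      = (a j : ℤ) - (if j = i then 1 else 0) := by
    intro j
    split_ifs with h
    · subst h
      push_cast [hai]
      rfl
    · simp
  have hsum : ∑ j ∈ univ.filter (fun j => Arr k j), (if j = i then (1 : ℤ) else 0)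
      = if Arr k i then 1 else 0 := by
    simp [Finset.sum_ite_eq']
  unfold bInt
  simp only [hcast, Finset.sum_sub_distrib, hsum]
  ring

open scoped Classical in
/-- `A_{i,ξ(i)-1}` written as a sum over vertices, using the height function. -/
theorem Amon_height {I : Type*} [Fintype I] (Arr : I → I → Prop) (ξ : I → ℤ)
    (hξ : ∀ i j, Arr i j → ξ j = ξ i - 1) (i : I) :
    Amon Arr i (ξ i - 1) = Ymon (i, ξ i - 2) + Ymon (i, ξ i)
      - (∑ j ∈ univ.filter (fun j => Arr i j), Ymon (j, ξ j)
        + ∑ j ∈ univ.filter (fun j => Arr j i), Ymon (j, ξ j - 2)) := by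
  have hdisj : Disjoint (univ.filter (fun j => Arr i j)) (univ.filter (fun j => Arr j i)) := by
    rw [Finset.disjoint_filter]
    intro j _ h h'
    have := hξ _ _ h
    have := hξ _ _ h'
    omega
  unfold Amon
  rw [Finset.filter_or, Finset.sum_union hdisj, sub_sub, sub_add_cancel, one_add_one_eq_two]
  congr 2
  · refine Finset.sum_congr rfl fun j hj => ?_
    rw [hξ i j (Finset.mem_filter.1 hj).2]
  · refine Finset.sum_congr rfl fun j hj => ?_
    rw [hξ j i (Finset.mem_filter.1 hj).2]
    congr 2
    ring

open scoped Classical in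
theorem stmt12 {I : Type*} [Fintype I] (Arr : I → I → Prop)
    (hloop : ∀ i, ¬ Arr i i)
    (ξ : I → ℤ) (hξ : ∀ i j, Arr i j → ξ j = ξ i - 1)
    (a : I → ℕ) (i : I)
    (hbi : 1 ≤ bInt Arr a i) :
    mMon Arr ξ a + Ymon (i, ξ i) - Amon Arr i (ξ i - 1)
      = mMon Arr ξ (fun k => a k - (if k = i then 1 else 0))
        + ∑ j ∈ univ.filter (fun j => Arr i j), Ymon (j, ξ j)
        + ∑ j ∈ univ.filter (fun j => Arr j i ∧ bInt Arr a j < 0),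
            (Ymon (j, ξ j - 2) + Ymon (j, ξ j)) := by
  have hai : 1 ≤ a i := by
    have h0 : (0 : ℤ) ≤ ∑ j ∈ univ.filter (fun j => Arr i j), (a j : ℤ) :=
      Finset.sum_nonneg fun j _ => by positivity
    unfold bInt at hbi
    omega
  have hterm : mMon Arr ξ a + ∑ j ∈ univ.filter (fun j => Arr j i), Ymon (j, ξ j - 2)
      = mMon Arr ξ (fun k => a k - (if k = i then 1 else 0))
        + ∑ j ∈ univ.filter (fun j => Arr j i ∧ bInt Arr a j < 0),
            (Ymon (j, ξ j - 2) + Ymon (j, ξ j))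
        + ∑ j, (if j = i then Ymon (j, ξ j - 2) else 0) := by
    unfold mMon
    simp only [Finset.sum_filter, ← Finset.sum_add_distrib, bInt_sub_single Arr a i hai]
    refine Finset.sum_congr rfl fun k _ => ?_
    by_cases hki : k = i
    · subst hki
      simp only [hloop k, if_true, if_false, false_and]
      rw [max_eq_left (by omega), max_eq_right (by omega), max_eq_left (by omega),
        max_eq_right (by omega)]
      module
    · by_cases hk : Arr k i
      · by_cases hb : bInt Arr a k < 0
        · simp only [hki, hk, hb, if_true, if_false, and_self]
          rw [max_eq_right (by omega), max_eq_left (by omega), max_eq_right (by omega),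
            max_eq_left (by omega)]
          module
        · simp only [hki, hk, hb, if_true, if_false, and_false]
          rw [max_eq_left (by omega), max_eq_right (by omega), max_eq_left (by omega),
            max_eq_right (by omega)]
          module
      · simp [hki, hk]
  rw [Finset.sum_ite_eq' univ i, if_pos (Finset.mem_univ i)] at hterm
  rw [Amon_height Arr ξ hξ, ← sub_eq_zero]
  rw [← sub_eq_zero] at hterm
  rw [← hterm]
  abel
end

section
/- Let Q be a finite quiver with vertex set I, with no loops and no multiple arrows, having at most one directed path (including paths of length 0) between any ordered pair of vertices; write i ∼ j when i and j are joined by an arrow. Let ξ : I → ℤ be a height function adapted to Q, i.e. ξ(j) = ξ(i) − 1 for every arrow i → j of Q. Let a : I → ℕ, set b_k := a_k − Σ_{arrows k → j} a_j, c_k := max(b_k, 0), d_k := max(−b_k, 0), and in the free abelian group with basis (Y_{i,p})_{(i,p) ∈ I × ℤ} set 𝔪_a := Σ_{k ∈ I} (c_k Y_{k,ξ(k)−2} + d_k Y_{k,ξ(k)}). Fix i ∈ I with a_i > 0, let in(i) denote the set of vertices k with a_k > 0 admitting a directed path from k to i all of whose vertices l satisfy a_l > 0, let γ := a − χ_{in(i)}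 (subtracting the indicator of in(i)), let ε := 1 if b_i > 0 and ε := 0 otherwise, and let T be the set of vertices k ∉ in(i) having an arrow k → j of Q with j ∈ in(i). Then every k ∈ T satisfies a_k = 0 and has exactly one such arrow, and 𝔪_a + Y_{i,ξ(i)} = 𝔪_γ + ε·(Y_{i,ξ(i)−2} + Y_{i,ξ(i)}) + Σ_{k ∈ T} Y_{k,ξ(k)}. -/
/-!
STATEMENT 13: the monomial counterpart of Lemma 6.9 of the paper, used in the proof of
Proposition 7.3: 𝔪_a + Y_{i,ξ(i)} = 𝔪_γ + ε·(Y_{i,ξ(i)−2} + Y_{i,ξ(i)}) + Σ_{k ∈ T} Y_{k,ξ(k)},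
together with the facts that every k ∈ T satisfies a_k = 0 and has exactly one arrow
into in(i).
-/

open Finset

section InSupp

variable {I : Type*} {Arr : I → I → Prop} {a : I → ℕ} {i j k : I}

theorem InSupp.exists_chain (h : InSupp Arr a i k) :
    ∃ l : List I, (k :: l).IsChain Arr ∧ (k :: l).getLast? = some i := by
  obtain ⟨l, hl, hlast⟩ := List.exists_isChain_cons_of_relationReflTransGen h.2
  refine ⟨l, hl.imp fun _ _ h => h.2.2, ?_⟩
  rw [List.getLast?_eq_getLast_of_ne_nil (List.cons_ne_nil k l), hlast]

/-- With unique paths, a vertex has at most one arrow into `in(i)`. -/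
theorem UniquePaths.eq_of_arr_inSupp (hU : UniquePaths Arr) {j₁ j₂ : I}
    (h₁ : Arr k j₁) (hj₁ : InSupp Arr a i j₁) (h₂ : Arr k j₂) (hj₂ : InSupp Arr a i j₂) :
    j₁ = j₂ := by
  obtain ⟨l₁, hc₁, hl₁⟩ := hj₁.exists_chain
  obtain ⟨l₂, hc₂, hl₂⟩ := hj₂.exists_chain
  have h := hU (k :: j₁ :: l₁) (k :: j₂ :: l₂)
    (List.isChain_cons_cons.2 ⟨h₁, hc₁⟩) (List.isChain_cons_cons.2 ⟨h₂, hc₂⟩)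
    (List.cons_ne_nil _ _) (List.cons_ne_nil _ _) rfl
    (by rw [List.getLast?_cons_cons, List.getLast?_cons_cons, hl₁, hl₂])
  simp only [List.cons.injEq, true_and] at h
  exact h.1

theorem InSupp.of_arr (hj : InSupp Arr a i j) (h : Arr k j) (hk : 0 < a k) :
    InSupp Arr a i k :=
  ⟨hk, .head ⟨hk, hj.1, h⟩ hj.2⟩

theorem InSupp.exists_arr (hk : InSupp Arr a i k) (hne : k ≠ i) :
    ∃ j, Arr k j ∧ InSupp Arr a i j := by
  obtain h | ⟨j, h, hj⟩ := hk.2.cases_head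
  · exact absurd h hne
  · exact ⟨j, h.2.2, h.2.1, hj⟩

theorem InSupp.height_le {ξ : I → ℤ} (hξ : ∀ i j, Arr i j → ξ j = ξ i - 1)
    (hk : InSupp Arr a i k) : ξ i ≤ ξ k := by
  have h := hk.2
  induction h using Relation.ReflTransGen.head_induction_on with
  | refl => exact le_rfl
  | head h hj ih =>
    have := hξ _ _ h.2.2
    have := ih ⟨h.2.1, hj⟩
    omega

theorem InSupp.not_arr_source {ξ : I → ℤ} (hξ : ∀ i j, Arr i j → ξ j = ξ i - 1)
    (hj : InSupp Arr a i j) : ¬ Arr i j := fun h => by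
  have := hξ _ _ h
  have := hj.height_le hξ
  omega

open scoped Classical in
theorem UniquePaths.sum_arr_inSupp [Fintype I] (hU : UniquePaths Arr) (a : I → ℕ) (i k : I) :
    ∑ j ∈ univ.filter (fun j => Arr k j), (if InSupp Arr a i j then 1 else 0 : ℤ)
      = if ∃ j, Arr k j ∧ InSupp Arr a i j then 1 else 0 := by
  split_ifs with h
  · obtain ⟨j, hj, hj'⟩ := h
    rw [Finset.sum_eq_single_of_mem j (by simpa using hj), if_pos hj']
    intro j₂ h₂ hne
    exact if_neg fun h' => hne (hU.eq_of_arr_inSupp (by simpa using h₂) h' hj hj')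
  · refine Finset.sum_eq_zero fun j hj => if_neg fun h' => h ⟨j, by simpa using hj, h'⟩

open scoped Classical in
theorem UniquePaths.bInt_sub_inSupp [Fintype I] (hU : UniquePaths Arr) (a : I → ℕ) (i k : I) :
    bInt Arr (fun k => a k - (if InSupp Arr a i k then 1 else 0)) k
      = bInt Arr a k - (if InSupp Arr a i k then 1 else 0)
        + (if ∃ j, Arr k j ∧ InSupp Arr a i j then 1 else 0) := by
  have hcast (j : I) : ((a j - (if InSupp Arr a i j then 1 else 0) : ℕ) : ℤ)
      = a j - (if InSupp Arr a i j then 1 else 0) := by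
    split_ifs with h
    · have := h.1
      omega
    · simp
  simp only [bInt, hcast, Finset.sum_sub_distrib, hU.sum_arr_inSupp]
  ring

open scoped Classical in
theorem bInt_neg_of_arr [Fintype I] (hk : a k = 0) (h : Arr k j) (hj : 0 < a j) :
    bInt Arr a k < 0 := by
  have : (a j : ℤ) ≤ ∑ j ∈ univ.filter (fun j => Arr k j), (a j : ℤ) :=
    Finset.single_le_sum (f := fun j => (a j : ℤ)) (fun _ _ => by positivity) (by simpa using h)
  unfold bInt
  omega

end InSupp

open scoped Classical in
theorem stmt13 {I : Type*} [Fintype I] (Arr : I → I → Prop)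
    (hloop : ∀ i, ¬ Arr i i)
    (hU : UniquePaths Arr)
    (ξ : I → ℤ) (hξ : ∀ i j, Arr i j → ξ j = ξ i - 1)
    (a : I → ℕ) (i : I) (hi : 0 < a i) :
    (∀ k ∈ univ.filter (fun k => ¬ InSupp Arr a i k ∧ ∃ j, Arr k j ∧ InSupp Arr a i j),
        a k = 0 ∧ ∃! j, Arr k j ∧ InSupp Arr a i j) ∧
      mMon Arr ξ a + Ymon (i, ξ i)
        = mMon Arr ξ (fun k => a k - (if InSupp Arr a i k then 1 else 0))
          + (if 0 < bInt Arr a i then 1 else 0 : ℤ) • (Ymon (i, ξ i - 2) + Ymon (i, ξ i))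
          + ∑ k ∈ univ.filter
              (fun k => ¬ InSupp Arr a i k ∧ ∃ j, Arr k j ∧ InSupp Arr a i j),
              Ymon (k, ξ k) := by
  have hT (k : I) (hk : ¬ InSupp Arr a i k ∧ ∃ j, Arr k j ∧ InSupp Arr a i j) : a k = 0 := by
    obtain ⟨hk, j, hkj, hj⟩ := hk
    exact Nat.eq_zero_of_not_pos fun h => hk (hj.of_arr hkj h)
  have hii : InSupp Arr a i i := ⟨hi, .refl⟩
  refine ⟨fun k hk => ?_, ?_⟩
  · rw [Finset.mem_filter_univ] at hk
    obtain ⟨j, hkj, hj⟩ := hk.2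
    exact ⟨hT k hk, j, ⟨hkj, hj⟩, fun j' h' => hU.eq_of_arr_inSupp h'.1 h'.2 hkj hj⟩
  have hsource : Ymon (i, ξ i) = ∑ k, if k = i then Ymon (k, ξ k) else 0 := by simp
  have hsource' : (if 0 < bInt Arr a i then 1 else 0 : ℤ) • (Ymon (i, ξ i - 2) + Ymon (i, ξ i))
      = ∑ k, if k = i then
          (if 0 < bInt Arr a k then 1 else 0 : ℤ) • (Ymon (k, ξ k - 2) + Ymon (k, ξ k))
        else 0 := by simp
  rw [hsource', hsource, Finset.sum_filter, mMon, mMon, ← Finset.sum_add_distrib,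
    ← Finset.sum_add_distrib, ← Finset.sum_add_distrib]
  refine Finset.sum_congr rfl fun k _ => ?_
  rw [hU.bInt_sub_inSupp]
  by_cases hki : k = i
  · subst hki
    have hno : ¬ ∃ j, Arr k j ∧ InSupp Arr a k j := fun ⟨j, h, hj⟩ => hj.not_arr_source hξ h
    simp only [hii, hno, if_true, if_false, not_true_eq_false, false_and]
    split_ifs with hb
    · rw [max_eq_left (by omega), max_eq_right (by omega), max_eq_left (by omega),
        max_eq_right (by omega)]
      module
    · rw [max_eq_right (by omega), max_eq_left (by omega), max_eq_right (by omega),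
        max_eq_left (by omega)]
      module
  by_cases hk : InSupp Arr a i k
  · simp [hki, hk, hk.exists_arr hki]
  by_cases hex : ∃ j, Arr k j ∧ InSupp Arr a i j
  · have hb : bInt Arr a k < 0 := by
      obtain ⟨j, hkj, hj⟩ := hex
      exact bInt_neg_of_arr (hT k ⟨hk, j, hkj, hj⟩) hkj hj.1
    simp only [hki, hk, hex, if_true, if_false, not_false_eq_true, and_self]
    rw [max_eq_right (by omega), max_eq_left (by omega), max_eq_right (by omega),
      max_eq_left (by omega)]
    module
  · simp [hki, hk, hex]
end
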